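/- Let E be a Banach space and 1 ≤ p < ∞. Then E has the κ_p-approximation property if and only if for every m ∈ ℕ and every Banach space F, the finite-rank polynomials P(^mF) ⊗ E are dense in the space P_{K_p}(^mF;E) of p-compact m-homogeneous polynomials with respect to the norm κ_p. -/

import Mathlib

open scoped ENNReal NNReal Classical
open Filter Metric

noncomputable section

/-- Membership in the closed unit ball of `ℓ_q`, where `q` is the conjugate exponent of `p`
(`q = ∞`, i.e. bounded coefficients, when `p = 1`). -/
def ConjUnitBall (p : ℝ) (α : ℕ → ℂ) : Prop :=
  if p = 1 then ∀ n, ‖α n‖ ≤ 1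
  else (Summable fun n => ‖α n‖ ^ (p / (p - 1))) ∧ (∑' n, ‖α n‖ ^ (p / (p - 1))) ≤ 1

variable {E F : Type*} [NormedAddCommGroup E] [NormedSpace ℂ E]
  [NormedAddCommGroup F] [NormedSpace ℂ F]

/-- The `p`-convex hull `p-co{x_n}` of a sequence `(x_n)`. -/
def pCo (p : ℝ) (x : ℕ → F) : Set F :=
  {y | ∃ α : ℕ → ℂ, ConjUnitBall p α ∧ HasSum (fun n => α n • x n) y}

/-- A set is relatively `p`-compact if it is contained in the `p`-convex hull of a
`p`-summable sequence. -/
def IsRelPCompact (p : ℝ) (K : Set F) : Prop :=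
  ∃ x : ℕ → F, (Summable fun n => ‖x n‖ ^ p) ∧ K ⊆ pCo p x

/-- The measure of `p`-compactness `m_p(K)`. -/
def mP (p : ℝ) (K : Set F) : ℝ :=
  sInf {r : ℝ | ∃ x : ℕ → F, (Summable fun n => ‖x n‖ ^ p) ∧ K ⊆ pCo p x ∧
    r = (∑' n, ‖x n‖ ^ p) ^ (1 / p)}

/-- `m_p(K)` as an element of `[0, ∞]`; it equals `∞` when `K` is not relatively
`p`-compact. -/
def mPE (p : ℝ) (K : Set F) : ℝ≥0∞ :=
  sInf {r : ℝ≥0∞ | ∃ x : ℕ → F, (Summable fun n => ‖x n‖ ^ p) ∧ K ⊆ pCo p x ∧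
    r = ENNReal.ofReal ((∑' n, ‖x n‖ ^ p) ^ (1 / p))}

/-- The `m`-homogeneous polynomial `P_m f(x₀)` in the Taylor series expansion of `f` at `x₀`. -/
def taylorPoly (f : E → F) (x₀ : E) (m : ℕ) (x : E) : F :=
  ((m.factorial : ℂ))⁻¹ • iteratedFDeriv ℂ m f x₀ fun _ => x

/-- `f` is `p`-compact at `x₀` if some neighborhood of `x₀` has relatively `p`-compact
image under `f`. -/
def PCompactAt (p : ℝ) (f : E → F) (x₀ : E) : Prop :=
  ∃ V ∈ nhds x₀, IsRelPCompact p (f '' V)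

/-- The radius of `p`-compact convergence of `f` at `x₀`:
`r_p(f, x₀) = 1 / limsup κ_p(P_mf(x₀))^{1/m}` (with the conventions `1/0 = ∞`, and
`κ_p(P) = ∞` when `P` is not `p`-compact, so that `r_p(f,x₀) = 0` in that case). -/
def pRadius (p : ℝ) (f : E → F) (x₀ : E) : ℝ≥0∞ :=
  (Filter.limsup (fun m : ℕ => (mPE p (taylorPoly f x₀ m '' closedBall 0 1)) ^ (1 / (m : ℝ)))
    Filter.atTop)⁻¹

/-- The `m`-homogeneous polynomial associated to a continuous `m`-linear map. -/
def polyEval {E F : Type*} [NormedAddCommGroup E] [NormedSpace ℂ E]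
    [NormedAddCommGroup F] [NormedSpace ℂ F] {m : ℕ}
    (A : ContinuousMultilinearMap ℂ (fun _ : Fin m => E) F) (x : E) : F :=
  A fun _ => x

universe u v

/-- A Banach space `E` has the `κ_p`-approximation property if for every Banach space `F`
the finite-rank operators `F' ⊗ E` are `κ_p`-dense in the space `K_p(F;E)` of `p`-compact
operators. -/
def HasKappaPApproxProp (p : ℝ) (E : Type v) [NormedAddCommGroup E] [NormedSpace ℂ E] : Prop :=
  ∀ (F : Type u) (_ : NormedAddCommGroup F) (_ : NormedSpace ℂ F) (_ : CompleteSpace F)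
    (T : F →L[ℂ] E), IsRelPCompact p (T '' closedBall 0 1) →
    ∀ ε : ℝ, 0 < ε →
      ∃ S : F →L[ℂ] E, FiniteDimensional ℂ (LinearMap.range (S : F →ₗ[ℂ] E)) ∧
        mP p ((fun x => T x - S x) '' closedBall 0 1) ≤ ε


theorem sum_superset_neg_one_pow_card {m : ℕ} (r : Fin m → Fin m) :
    ∑ S : Finset (Fin m), (if ∀ i, r i ∈ S then (-1 : ℂ) ^ S.card else 0) =
      if Function.Surjective r then (-1) ^ m else 0 := by
  have h := Finset.prod_add (fun _ : Fin m => (-1 : ℂ))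
    (fun i => if ∃ j, r j = i then 0 else 1) Finset.univ
  rw [Finset.powerset_univ] at h
  have hl : ∏ i : Fin m, ((-1 : ℂ) + if ∃ j, r j = i then 0 else 1) =
      if Function.Surjective r then (-1) ^ m else 0 := by
    split_ifs with hr
    · have hr' : ∀ i, ∃ j, r j = i := hr
      simp [hr']
    · obtain ⟨i, hi⟩ := not_forall.1 hr
      exact Finset.prod_eq_zero (Finset.mem_univ i) (by simp [hi])
  rw [← hl, h]
  refine Finset.sum_congr rfl fun S _ => ?_
  rw [Finset.prod_const]
  split_ifs with hS
  · rw [Finset.prod_eq_one, mul_one]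
    intro i hi
    rw [if_neg]
    rintro ⟨j, rfl⟩
    exact (Finset.mem_sdiff.1 hi).2 (hS j)
  · obtain ⟨i, hi⟩ := not_forall.1 hS
    rw [Finset.prod_eq_zero (i := r i) (by simp [hi]) (by simp), mul_zero]

/-- The polarization identity for a multilinear map that need not be symmetric. -/
theorem MultilinearMap.sum_perm_eq_polarization {V W : Type*} [AddCommGroup V] [Module ℂ V]
    [AddCommGroup W] [Module ℂ W] {m : ℕ} (A : MultilinearMap ℂ (fun _ : Fin m => V) W)
    (x : Fin m → V) :
    ∑ σ : Equiv.Perm (Fin m), A (fun i => x (σ i)) =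
      ∑ S : Finset (Fin m), ((-1 : ℂ) ^ m * (-1) ^ S.card) • A (fun _ => ∑ i ∈ S, x i) := by
  have hS : ∀ S : Finset (Fin m), ((-1 : ℂ) ^ m * (-1) ^ S.card) • A (fun _ => ∑ i ∈ S, x i) =
      ∑ r : Fin m → Fin m,
        ((-1 : ℂ) ^ m * if ∀ i, r i ∈ S then (-1) ^ S.card else 0) • A (fun i => x (r i)) := by
    intro S
    rw [A.map_sum_finset (fun _ j => x j) (fun _ => S), Finset.smul_sum]
    have : Fintype.piFinset (fun _ : Fin m => S) = Finset.univ.filter fun r => ∀ i, r i ∈ S := by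
      ext r; simp
    rw [this, Finset.sum_filter]
    refine Finset.sum_congr rfl fun r _ => ?_
    split_ifs <;> simp
  simp_rw [hS]
  rw [Finset.sum_comm]
  simp_rw [← Finset.sum_smul, ← Finset.mul_sum, sum_superset_neg_one_pow_card]
  have h1 : ∀ r : Fin m → Fin m,
      ((-1 : ℂ) ^ m * if Function.Surjective r then (-1) ^ m else 0) • A (fun i => x (r i)) =
        if Function.Bijective r then A (fun i => x (r i)) else 0 := by
    intro r
    by_cases hr : Function.Surjective r
    · rw [if_pos hr, if_pos (Finite.surjective_iff_bijective.1 hr), ← mul_pow]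
      simp
    · rw [if_neg hr, if_neg (mt Function.Bijective.surjective hr), mul_zero, zero_smul]
  simp_rw [h1]
  rw [← Finset.sum_filter]
  exact Finset.sum_bij (fun σ _ => σ) (fun σ _ => Finset.mem_filter.2 ⟨Finset.mem_univ _, σ.bijective⟩)
    (fun σ _ τ _ h => Equiv.coe_fn_injective h)
    (fun r hr => ⟨Equiv.ofBijective r (Finset.mem_filter.1 hr).2, Finset.mem_univ _, rfl⟩)
    fun _ _ => rfl

theorem MultilinearMap.norm_le_mul_prod_of_forall_norm_le_one {V W : Type*}
    [NormedAddCommGroup V] [NormedSpace ℂ V] [NormedAddCommGroup W] [NormedSpace ℂ W] {m : ℕ}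
    (B : MultilinearMap ℂ (fun _ : Fin m => V) W) {C : ℝ}
    (hB : ∀ x : Fin m → V, (∀ i, ‖x i‖ ≤ 1) → ‖B x‖ ≤ C) (x : Fin m → V) :
    ‖B x‖ ≤ C * ∏ i, ‖x i‖ := by
  by_cases h0 : ∃ i, x i = 0
  · obtain ⟨i, hi⟩ := h0
    rw [B.map_coord_zero i hi, Finset.prod_eq_zero (Finset.mem_univ i) (by simp [hi])]
    simp
  push Not at h0
  have hx : x = fun i => (‖x i‖ : ℂ) • ((‖x i‖ : ℂ)⁻¹ • x i) := by
    funext i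
    rw [smul_smul, mul_inv_cancel₀ (by simpa using h0 i), one_smul]
  have hu := hB (fun i => (‖x i‖ : ℂ)⁻¹ • x i) fun i => by
    rw [norm_smul, norm_inv, Complex.norm_real, norm_norm,
      inv_mul_cancel₀ (by simpa using h0 i)]
  calc ‖B x‖ = ‖B fun i => (‖x i‖ : ℂ) • ((‖x i‖ : ℂ)⁻¹ • x i)‖ := by rw [← hx]
    _ = (∏ i, ‖x i‖) * ‖B fun i => (‖x i‖ : ℂ)⁻¹ • x i‖ := by
      rw [B.map_smul_univ, norm_smul, norm_prod]
      simp
    _ ≤ (∏ i, ‖x i‖) * C := by gcongr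
    _ = _ := mul_comm _ _

/-- A homogeneous polynomial mapping the unit ball into the image of the unit ball under an
injective operator factors through that operator. -/
theorem exists_polyEval_comp_eq {F G E : Type*} [NormedAddCommGroup F] [NormedSpace ℂ F]
    [NormedAddCommGroup G] [NormedSpace ℂ G] [NormedAddCommGroup E] [NormedSpace ℂ E] {m : ℕ}
    (A : ContinuousMultilinearMap ℂ (fun _ : Fin m => F) E) (T : G →L[ℂ] E)
    (hT : Function.Injective T)
    (hA : polyEval A '' closedBall 0 1 ⊆ T '' closedBall 0 1) :
    ∃ B : ContinuousMultilinearMap ℂ (fun _ : Fin m => F) G,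
      ∀ x, T (polyEval B x) = polyEval A x := by
  have hP : ∀ y : F, ‖y‖ ≤ m + 1 → ∃ g : G, ‖g‖ ≤ ((m : ℝ) + 1) ^ m ∧ T g = A fun _ => y := by
    intro y hy
    have hc : (0 : ℝ) < m + 1 := by positivity
    have hc' : ((m : ℂ) + 1) ≠ 0 := by exact_mod_cast hc.ne'
    have hn : ‖(m : ℂ) + 1‖ = m + 1 := by
      rw [← Nat.cast_succ, Complex.norm_natCast]; simp
    obtain ⟨g, hg, hgy⟩ := hA ⟨((m : ℂ) + 1)⁻¹ • y, by
      rw [mem_closedBall_zero_iff, norm_smul, norm_inv, hn, inv_mul_le_iff₀ hc]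
      simpa using hy, rfl⟩
    refine ⟨((m : ℂ) + 1) ^ m • g, ?_, ?_⟩
    · rw [norm_smul, norm_pow, hn]
      exact mul_le_of_le_one_right (by positivity) (mem_closedBall_zero_iff.1 hg)
    · rw [map_smul, hgy, polyEval]
      have := A.map_smul_univ (fun _ => (m : ℂ) + 1) (fun _ => ((m : ℂ) + 1)⁻¹ • y)
      simp only [Finset.prod_const, Finset.card_univ, Fintype.card_fin] at this
      rw [← this]
      simp [smul_smul, hc']
  let As : MultilinearMap ℂ (fun _ : Fin m => F) E :=
    ∑ σ : Equiv.Perm (Fin m), A.toMultilinearMap.domDomCongr σ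
  have hAs : ∀ x, As x =
      ∑ S : Finset (Fin m), ((-1 : ℂ) ^ m * (-1) ^ S.card) • A (fun _ => ∑ i ∈ S, x i) := by
    intro x
    rw [← ContinuousMultilinearMap.coe_coe, ← A.toMultilinearMap.sum_perm_eq_polarization x]
    simp [As]
  have hbd : ∀ x : Fin m → F, (∀ i, ‖x i‖ ≤ 1) →
      ∃ g : G, ‖g‖ ≤ ∑ _S : Finset (Fin m), ((m : ℝ) + 1) ^ m ∧ T g = As x := by
    intro x hx
    have hS : ∀ S : Finset (Fin m), ‖∑ i ∈ S, x i‖ ≤ m + 1 := fun S => calc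
      ‖∑ i ∈ S, x i‖ ≤ ∑ i ∈ S, ‖x i‖ := norm_sum_le _ _
      _ ≤ ∑ i ∈ S, (1 : ℝ) := Finset.sum_le_sum fun i _ => hx i
      _ = S.card := by simp
      _ ≤ m := by exact_mod_cast (Finset.card_le_univ S).trans_eq (Fintype.card_fin m)
      _ ≤ m + 1 := by linarith
    choose g hg hgT using fun S => hP _ (hS S)
    refine ⟨∑ S : Finset (Fin m), ((-1 : ℂ) ^ m * (-1) ^ S.card) • g S, ?_, ?_⟩
    · refine (norm_sum_le _ _).trans (Finset.sum_le_sum fun S _ => ?_)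
      rw [norm_smul]
      simpa using hg S
    · rw [map_sum, hAs]
      exact Finset.sum_congr rfl fun S _ => by rw [map_smul, hgT]
  have hrange : ∀ x, As x ∈ LinearMap.range (T : G →ₗ[ℂ] E) := by
    intro x
    have h1 : ∀ y : F, (A fun _ => y) ∈ LinearMap.range (T : G →ₗ[ℂ] E) := by
      intro y
      let c : ℂ := (‖y‖ : ℂ) + 1
      have hc : c ≠ 0 := by
        have : (0 : ℝ) < ‖y‖ + 1 := by positivity
        simp only [c]; exact_mod_cast this.ne'
      have hn : ‖c‖ = ‖y‖ + 1 := by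
        rw [show c = ((‖y‖ + 1 : ℝ) : ℂ) by simp [c], Complex.norm_real, Real.norm_of_nonneg]
        positivity
      obtain ⟨g, -, hg⟩ := hP (c⁻¹ • y) (by
        rw [norm_smul, norm_inv, hn, inv_mul_le_iff₀ (by positivity)]
        nlinarith [norm_nonneg y, (Nat.cast_nonneg m : (0 : ℝ) ≤ m)])
      refine ⟨c ^ m • g, ?_⟩
      have := A.map_smul_univ (fun _ => c) (fun _ => c⁻¹ • y)
      simp only [Finset.prod_const, Finset.card_univ, Fintype.card_fin] at this
      rw [map_smul, ContinuousLinearMap.coe_coe, hg, ← this]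
      simp [smul_smul, hc]
    rw [hAs]
    exact Submodule.sum_mem _ fun S _ => Submodule.smul_mem _ _ (h1 _)
  let e := LinearEquiv.ofInjective (T : G →ₗ[ℂ] E) hT
  let B₀ : MultilinearMap ℂ (fun _ : Fin m => F) G :=
    (e.symm : _ →ₗ[ℂ] G).compMultilinearMap (As.codRestrict _ hrange)
  have hB₀ : ∀ x, T (B₀ x) = As x := fun x =>
    congrArg Subtype.val (e.apply_symm_apply (As.codRestrict _ hrange x))
  have hB₀bd : ∀ x, ‖B₀ x‖ ≤ (∑ _S : Finset (Fin m), ((m : ℝ) + 1) ^ m) * ∏ i, ‖x i‖ := by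
    refine B₀.norm_le_mul_prod_of_forall_norm_le_one fun x hx => ?_
    obtain ⟨g, hg, hgT⟩ := hbd x hx
    rwa [hT ((hB₀ x).trans hgT.symm)]
  refine ⟨((m.factorial : ℂ))⁻¹ • B₀.mkContinuous _ hB₀bd, fun x => ?_⟩
  have : (m.factorial : ℂ) ≠ 0 := by exact_mod_cast m.factorial_ne_zero
  simp only [polyEval, smul_apply, map_smul,
    MultilinearMap.coe_mkContinuous, hB₀]
  rw [inv_smul_eq_iff₀ this]
  simp [As, Fintype.card_perm, ← Nat.cast_smul_eq_nsmul ℂ]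

/-- The exponent conjugate to `p`, as an extended nonnegative real. -/
def conjExp (p : ℝ) : ℝ≥0∞ :=
  if p = 1 then ∞ else ENNReal.ofReal (p / (p - 1))

theorem conjExp_one : conjExp 1 = ∞ := if_pos rfl

theorem toReal_conjExp {p : ℝ} (hp : 1 < p) : (conjExp p).toReal = p / (p - 1) := by
  rw [conjExp, if_neg hp.ne',
    ENNReal.toReal_ofReal (div_nonneg (by linarith) (by linarith))]

theorem one_le_div_sub_one {p : ℝ} (hp : 1 < p) : 1 ≤ p / (p - 1) := by
  rw [le_div_iff₀ (by linarith)]; linarith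

theorem one_le_conjExp {p : ℝ} (hp : 1 ≤ p) : 1 ≤ conjExp p := by
  rcases hp.eq_or_lt with rfl | hp
  · simp [conjExp_one]
  · rw [conjExp, if_neg hp.ne', ENNReal.one_le_ofReal]
    exact one_le_div_sub_one hp

theorem ConjUnitBall.exists_lp {p : ℝ} (hp : 1 ≤ p) {α : ℕ → ℂ} (hα : ConjUnitBall p α) :
    ∃ a : lp (fun _ : ℕ => ℂ) (conjExp p), ‖a‖ ≤ 1 ∧ ⇑a = α := by
  rcases hp.eq_or_lt with rfl | hp
  · rw [ConjUnitBall, if_pos rfl] at hα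
    rw [conjExp_one]
    exact ⟨⟨α, memℓp_infty ⟨1, Set.forall_mem_range.2 hα⟩⟩,
      lp.norm_le_of_forall_le zero_le_one hα, rfl⟩
  · rw [ConjUnitBall, if_neg hp.ne', ← toReal_conjExp hp] at hα
    have h0 : 0 < (conjExp p).toReal := by
      rw [toReal_conjExp hp]; linarith [one_le_div_sub_one hp]
    exact ⟨⟨α, memℓp_gen hα.1⟩,
      lp.norm_le_of_tsum_le h0 zero_le_one (by simpa using hα.2), rfl⟩

theorem conjUnitBall_of_norm_le_one {p : ℝ} (hp : 1 ≤ p)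
    (a : lp (fun _ : ℕ => ℂ) (conjExp p)) (ha : ‖a‖ ≤ 1) : ConjUnitBall p a := by
  rcases hp.eq_or_lt with rfl | hp
  · rw [ConjUnitBall, if_pos rfl]
    exact fun n => (lp.norm_apply_le_norm (by simp [conjExp_one]) a n).trans ha
  · have h0 : 0 < (conjExp p).toReal := by
      rw [toReal_conjExp hp]; linarith [one_le_div_sub_one hp]
    rw [ConjUnitBall, if_neg hp.ne', ← toReal_conjExp hp]
    refine ⟨(lp.memℓp a).summable h0, ?_⟩
    rw [← lp.norm_rpow_eq_tsum h0]
    exact Real.rpow_le_one (lp.norm_nonneg' a) ha h0.le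

theorem summable_mul_norm_and_tsum_le {V : Type*} [NormedAddCommGroup V] {p : ℝ}
    (hp : 1 ≤ p) {x : ℕ → V}
    (hx : Summable fun n => ‖x n‖ ^ p) (a : lp (fun _ : ℕ => ℂ) (conjExp p)) :
    (Summable fun n => ‖a n‖ * ‖x n‖) ∧
      ∑' n, ‖a n‖ * ‖x n‖ ≤ (∑' n, ‖x n‖ ^ p) ^ (1 / p) * ‖a‖ := by
  rcases hp.eq_or_lt with rfl | hp
  · simp only [Real.rpow_one, div_one] at hx ⊢
    have hle : ∀ n, ‖a n‖ * ‖x n‖ ≤ ‖a‖ * ‖x n‖ := fun n => by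
      gcongr
      exact lp.norm_apply_le_norm (by simp [conjExp_one]) a n
    have hs := Summable.of_nonneg_of_le (fun n => by positivity) hle (hx.mul_left ‖a‖)
    refine ⟨hs, (hs.tsum_le_tsum hle (hx.mul_left _)).trans_eq ?_⟩
    rw [tsum_mul_left, mul_comm]
  · have h0 : 0 < (conjExp p).toReal := by
      rw [toReal_conjExp hp]; linarith [one_le_div_sub_one hp]
    have hpq : p.HolderConjugate (conjExp p).toReal := by
      rw [toReal_conjExp hp]
      exact Real.HolderConjugate.conjExponent hp
    have := Real.summable_and_inner_le_Lp_mul_Lq_tsum_of_nonneg hpq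
      (fun n => norm_nonneg (x n)) (fun n => norm_nonneg (a n)) hx ((lp.memℓp a).summable h0)
    simpa only [lp.norm_eq_tsum_rpow h0, mul_comm ‖a _‖] using this

theorem summable_smul_of_lp [CompleteSpace E] {p : ℝ} (hp : 1 ≤ p) {x : ℕ → E}
    (hx : Summable fun n => ‖x n‖ ^ p) (a : lp (fun _ : ℕ => ℂ) (conjExp p)) :
    Summable fun n => a n • x n :=
  .of_norm (by simpa only [norm_smul] using (summable_mul_norm_and_tsum_le hp hx a).1)

/-- The operator `a ↦ ∑ a_n x_n` on `ℓ_q` induced by a `p`-summable sequence `x`. -/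
def lpSynthesis [CompleteSpace E] {p : ℝ} (hp : 1 ≤ p) [Fact (1 ≤ conjExp p)] {x : ℕ → E}
    (hx : Summable fun n => ‖x n‖ ^ p) : lp (fun _ : ℕ => ℂ) (conjExp p) →L[ℂ] E :=
  LinearMap.mkContinuous
    { toFun := fun a => ∑' n, a n • x n
      map_add' := fun a b => by
        rw [← (summable_smul_of_lp hp hx a).tsum_add (summable_smul_of_lp hp hx b)]
        simp [add_smul]
      map_smul' := fun c a => by
        rw [RingHom.id_apply, ← (summable_smul_of_lp hp hx a).tsum_const_smul]
        simp [mul_smul] }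
    ((∑' n, ‖x n‖ ^ p) ^ (1 / p)) fun a => by
      have h := summable_mul_norm_and_tsum_le hp hx a
      refine (norm_tsum_le_tsum_norm ?_).trans ?_
      · simpa only [norm_smul] using h.1
      · simpa only [norm_smul] using h.2

theorem hasSum_lpSynthesis [CompleteSpace E] {p : ℝ} (hp : 1 ≤ p) [Fact (1 ≤ conjExp p)]
    {x : ℕ → E} (hx : Summable fun n => ‖x n‖ ^ p) (a : lp (fun _ : ℕ => ℂ) (conjExp p)) :
    HasSum (fun n => a n • x n) (lpSynthesis hp hx a) :=
  (summable_smul_of_lp hp hx a).hasSum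

theorem Summable.norm_smul_rpow {p : ℝ} {x : ℕ → E} (hx : Summable fun n => ‖x n‖ ^ p) (c : ℂ) :
    Summable fun n => ‖c • x n‖ ^ p := by
  simpa only [norm_smul, Real.mul_rpow (norm_nonneg _) (norm_nonneg _)] using
    hx.mul_left (‖c‖ ^ p)

/-- A relatively `p`-compact set lies in the image of the unit ball under an injective
`p`-compact operator defined on a Banach space, a quotient of `ℓ_q`. -/
theorem IsRelPCompact.exists_injective_operator [CompleteSpace E] {p : ℝ} (hp : 1 ≤ p)
    {K : Set E} (hK : IsRelPCompact p K) :
    ∃ (G : Type u) (_ : NormedAddCommGroup G) (_ : NormedSpace ℂ G) (_ : CompleteSpace G)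
      (T : G →L[ℂ] E), Function.Injective T ∧ IsRelPCompact p (T '' closedBall 0 1) ∧
        K ⊆ T '' closedBall 0 1 := by
  obtain ⟨x, hx, hKx⟩ := hK
  have : Fact (1 ≤ conjExp p) := ⟨one_le_conjExp hp⟩
  let θ := lpSynthesis hp hx
  let N := LinearMap.ker (θ : lp (fun _ : ℕ => ℂ) (conjExp p) →ₗ[ℂ] E)
  have : IsClosed (N : Set (lp (fun _ : ℕ => ℂ) (conjExp p))) := θ.isClosed_ker
  let T₀ : (lp (fun _ : ℕ => ℂ) (conjExp p) ⧸ N) →L[ℂ] E := N.liftQL θ le_rfl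
  have hT₀ : Function.Injective T₀ := by
    rw [← ContinuousLinearMap.coe_coe, ← LinearMap.ker_eq_bot]
    exact Submodule.ker_liftQ_eq_bot _ _ _ le_rfl
  let e : ULift.{u} (lp (fun _ : ℕ => ℂ) (conjExp p) ⧸ N) ≃ₗᵢ[ℂ]
      lp (fun _ : ℕ => ℂ) (conjExp p) ⧸ N := LinearIsometryEquiv.ulift ℂ _
  refine ⟨ULift.{u} (lp (fun _ : ℕ => ℂ) (conjExp p) ⧸ N), inferInstance, inferInstance,
    inferInstance, T₀.comp e.toContinuousLinearEquiv.toContinuousLinearMap, hT₀.comp e.injective,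
    ⟨fun n => (2 : ℂ) • x n, hx.norm_smul_rpow 2, ?_⟩, ?_⟩
  · rintro _ ⟨g, hg, rfl⟩
    have hg' : ‖e g‖ ≤ 1 := by simpa using hg
    obtain ⟨a, ha, han⟩ := Submodule.Quotient.norm_mk_lt (e g) one_pos
    have ha2 : ‖(2 : ℂ)⁻¹ • a‖ ≤ 1 := by
      rw [norm_smul, norm_inv, Complex.norm_ofNat]; linarith
    refine ⟨_, conjUnitBall_of_norm_le_one hp _ ha2, ?_⟩
    have hv : T₀ (e g) = θ a := by rw [← ha]; rfl
    have := hasSum_lpSynthesis hp hx a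
    simpa [smul_smul, hv, mul_right_comm] using this
  · intro y hy
    obtain ⟨α, hα, hy⟩ := hKx hy
    obtain ⟨a, ha, rfl⟩ := hα.exists_lp hp
    refine ⟨e.symm (N.mkQ a), ?_, ?_⟩
    · rw [mem_closedBall_zero_iff, LinearIsometryEquiv.norm_map]
      exact (Submodule.Quotient.norm_mk_le N a).trans ha
    · have hv : T₀ (N.mkQ a) = θ a := rfl
      change T₀ (e (e.symm (N.mkQ a))) = y
      rw [e.apply_symm_apply, hv]
      exact (hasSum_lpSynthesis hp hx a).unique hy

/-- The sequence `a, f 0, f 1, …`. -/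
def seqCons {X : Type*} (a : X) (f : ℕ → X) : ℕ → X
  | 0 => a
  | n + 1 => f n

theorem IsRelPCompact.image_add_smul {X : Type*} {p : ℝ} (hp : 1 ≤ p) {B : Set X} {f : X → E}
    (hf : IsRelPCompact p (f '' B)) {φ : X → ℂ} {M : ℝ} (hφ : ∀ x ∈ B, ‖φ x‖ ≤ M) (v : E) :
    IsRelPCompact p ((fun x => f x + φ x • v) '' B) := by
  obtain ⟨x, hx, hfx⟩ := hf
  obtain ⟨c, hc2, hcM⟩ : ∃ c : ℝ, 2 ≤ c ∧ 2 * M ≤ c := 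
    ⟨max 2 (2 * M), le_max_left .., le_max_right ..⟩
  have hc0 : 0 < c := by linarith
  have hcC : (c : ℂ) ≠ 0 := by exact_mod_cast hc0.ne'
  have hcn : ‖(c : ℂ)‖ = c := by rw [Complex.norm_real, Real.norm_of_nonneg hc0.le]
  have hcinv : c⁻¹ ≤ 1 / 2 := by rw [one_div]; exact inv_anti₀ two_pos hc2
  refine ⟨seqCons ((c : ℂ) • v) fun k => (c : ℂ) • x k,
    (summable_nat_add_iff 1).1 (hx.norm_smul_rpow c), ?_⟩
  rintro _ ⟨b, hb, rfl⟩
  obtain ⟨α, hα, hsum⟩ := hfx ⟨b, hb, rfl⟩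
  refine ⟨seqCons ((c : ℂ)⁻¹ * φ b) fun k => (c : ℂ)⁻¹ * α k, ?_, ?_⟩
  · have h0 : ‖(c : ℂ)⁻¹ * φ b‖ ≤ 1 / 2 := by
      rw [norm_mul, norm_inv, hcn, inv_mul_le_iff₀ hc0]
      linarith [hφ b hb]
    have h1 : ∀ k, ‖(c : ℂ)⁻¹ * α k‖ ≤ 1 / 2 * ‖α k‖ := fun k => by
      rw [norm_mul, norm_inv, hcn]; gcongr
    by_cases hp1 : p = 1
    · rw [ConjUnitBall, if_pos hp1] at hα ⊢
      rintro (_ | k)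
      · exact h0.trans (by norm_num)
      · exact (h1 k).trans (by linarith [hα k])
    · rw [ConjUnitBall, if_neg hp1] at hα ⊢
      have hq := one_le_div_sub_one (lt_of_le_of_ne hp (Ne.symm hp1))
      set q := p / (p - 1)
      have hhalf : (1 / 2 : ℝ) ^ q ≤ 1 / 2 := by
        simpa using Real.rpow_le_rpow_of_exponent_ge (x := 1 / 2) (by norm_num) (by norm_num) hq
      have h2 : ∀ k, ‖(c : ℂ)⁻¹ * α k‖ ^ q ≤ 1 / 2 * ‖α k‖ ^ q := fun k => calc
        _ ≤ (1 / 2 * ‖α k‖) ^ q := by gcongr; exact h1 k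
        _ = (1 / 2) ^ q * ‖α k‖ ^ q := Real.mul_rpow (by norm_num) (norm_nonneg _)
        _ ≤ _ := by gcongr
      have hs : Summable fun k => ‖(c : ℂ)⁻¹ * α k‖ ^ q :=
        .of_nonneg_of_le (fun k => by positivity) h2 (hα.1.mul_left _)
      have hs' : Summable fun n : ℕ =>
          ‖seqCons ((c : ℂ)⁻¹ * φ b) (fun k => (c : ℂ)⁻¹ * α k) n‖ ^ q :=
        (summable_nat_add_iff 1).1 hs
      refine ⟨hs', ?_⟩
      rw [hs'.tsum_eq_zero_add]
      have h3 : ‖(c : ℂ)⁻¹ * φ b‖ ^ q ≤ 1 / 2 :=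
        (Real.rpow_le_rpow (norm_nonneg _) h0 (by linarith)).trans hhalf
      have h4 : ∑' k, ‖(c : ℂ)⁻¹ * α k‖ ^ q ≤ 1 / 2 := by
        refine (hs.tsum_le_tsum h2 (hα.1.mul_left _)).trans ?_
        rw [tsum_mul_left]; linarith [hα.2]
      exact (add_le_add h3 h4).trans (by norm_num)
  · rw [← hasSum_nat_add_iff' 1]
    have hcancel : ∀ (z : ℂ) (w : E), ((c : ℂ)⁻¹ * z) • (c : ℂ) • w = z • w := fun z w => by
      rw [smul_smul, mul_right_comm, inv_mul_cancel₀ hcC, one_mul]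
    simpa only [seqCons, Finset.sum_range_one, hcancel, add_sub_cancel_right] using hsum

theorem IsRelPCompact.image_sub_sum_smul {X ι : Type*} {p : ℝ} (hp : 1 ≤ p) {B : Set X}
    {f : X → E} (hf : IsRelPCompact p (f '' B)) (s : Finset ι) {φ : ι → X → ℂ} {M : ι → ℝ}
    (hφ : ∀ i, ∀ x ∈ B, ‖φ i x‖ ≤ M i) (v : ι → E) :
    IsRelPCompact p ((fun x => f x - ∑ i ∈ s, φ i x • v i) '' B) := by
  induction s using Finset.induction_on with
  | empty => simpa using hf
  | insert i s hi ih =>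
    convert ih.image_add_smul hp (hφ i) (-v i) using 3 with x
    rw [Finset.sum_insert hi, smul_neg]
    abel

theorem mP_mono {p : ℝ} {K L : Set E} (hKL : K ⊆ L) (hL : IsRelPCompact p L) :
    mP p K ≤ mP p L := by
  refine csInf_le_csInf ⟨0, ?_⟩ ?_ ?_
  · rintro _ ⟨x, -, -, rfl⟩
    exact Real.rpow_nonneg (tsum_nonneg fun n => by positivity) _
  · obtain ⟨x, hx, hLx⟩ := hL
    exact ⟨_, x, hx, hLx, rfl⟩
  · rintro _ ⟨x, hx, hLx, rfl⟩
    exact ⟨x, hx, hKL.trans hLx, rfl⟩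

theorem ContinuousLinearMap.exists_eq_sum_smul_of_finiteDimensional_range (S : F →L[ℂ] E)
    (hS : FiniteDimensional ℂ (LinearMap.range (S : F →ₗ[ℂ] E))) :
    ∃ (n : ℕ) (φ : Fin n → F →L[ℂ] ℂ) (v : Fin n → E), ∀ x, S x = ∑ i, φ i x • v i := by
  let b := Module.finBasis ℂ (LinearMap.range (S : F →ₗ[ℂ] E))
  let S' : F →L[ℂ] LinearMap.range (S : F →ₗ[ℂ] E) := S.codRestrict _ fun x => ⟨x, rfl⟩
  refine ⟨_, fun i => (LinearMap.toContinuousLinearMap (b.coord i)).comp S', fun i => b i,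
    fun x => ?_⟩
  refine (congrArg Subtype.val (b.sum_repr (S' x))).symm.trans ?_
  rw [Submodule.coe_sum]
  rfl

/-- **Theorem 5.6 ((i) ⇔ (ii)).** A Banach space `E` has the `κ_p`-approximation property
if and only if for every `m ∈ ℕ` and every Banach space `F`, the finite-rank polynomials
`P(^mF) ⊗ E` are `κ_p`-dense in the space `P_{K_p}(^mF;E)` of `p`-compact `m`-homogeneous
polynomials. -/
theorem statement19 (E : Type u) [NormedAddCommGroup E] [NormedSpace ℂ E] [CompleteSpace E]
    (p : ℝ) (hp : 1 ≤ p) :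
    HasKappaPApproxProp.{u} p E ↔
      ∀ (m : ℕ) (F : Type u)
        (_ : NormedAddCommGroup F) (_ : NormedSpace ℂ F) (_ : CompleteSpace F)
        (A : ContinuousMultilinearMap ℂ (fun _ : Fin m => F) E),
        IsRelPCompact p (polyEval A '' closedBall 0 1) →
        ∀ ε : ℝ, 0 < ε →
          ∃ (n : ℕ) (q : Fin n → ContinuousMultilinearMap ℂ (fun _ : Fin m => F) ℂ)
            (v : Fin n → E),
            mP p ((fun x => polyEval A x - ∑ i, polyEval (q i) x • v i) ''
              closedBall 0 1) ≤ ε := by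
  constructor
  · intro hE m F _ _ _ A hA ε hε
    obtain ⟨G, _, _, _, T, hTinj, hT, hAT⟩ := hA.exists_injective_operator hp
    obtain ⟨B, hB⟩ := exists_polyEval_comp_eq A T hTinj hAT
    obtain ⟨S, hSfin, hS⟩ := hE G _ _ inferInstance T hT ε hε
    obtain ⟨n, φ, v, hφ⟩ := S.exists_eq_sum_smul_of_finiteDimensional_range hSfin
    refine ⟨n, fun i => (φ i).compContinuousMultilinearMap B, v, le_trans (mP_mono ?_ ?_) hS⟩
    · rintro _ ⟨x, hx, rfl⟩
      obtain ⟨g, hg, hgx⟩ := hAT ⟨x, hx, rfl⟩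
      refine ⟨g, hg, ?_⟩
      obtain rfl : g = polyEval B x := hTinj (hgx.trans (hB x).symm)
      simp only [hφ, hB]
      rfl
    · simp only [hφ]
      exact hT.image_sub_sum_smul hp _ (M := fun i => ‖φ i‖)
        (fun i x hx => (φ i).unit_le_opNorm x (mem_closedBall_zero_iff.1 hx)) v
  · intro h F _ _ _ T hT ε hε
    let A : ContinuousMultilinearMap ℂ (fun _ : Fin 1 => F) E :=
      ContinuousMultilinearMap.ofSubsingleton ℂ F E 0 T
    have hA : polyEval A = T := by
      funext x; simp [A, polyEval]
    obtain ⟨n, q, v, hq⟩ := h 1 F _ _ inferInstance A (by rwa [hA]) ε hε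
    let φ : Fin n → F →L[ℂ] ℂ := fun i =>
      (ContinuousMultilinearMap.ofSubsingleton ℂ F ℂ (0 : Fin 1)).symm (q i)
    have hφ : ∀ i x, φ i x = polyEval (q i) x := fun i x => by
      simp [φ, polyEval]
    let S : F →L[ℂ] E := ∑ i, (φ i).smulRight (v i)
    have hSx : ∀ x, S x = ∑ i, polyEval (q i) x • v i := fun x => by
      simp [S, hφ]
    refine ⟨S, ?_, ?_⟩
    · have := FiniteDimensional.span_of_finite ℂ (Set.finite_range v)
      refine Submodule.finiteDimensional_of_le (S₂ := Submodule.span ℂ (Set.range v)) ?_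
      rintro _ ⟨x, rfl⟩
      rw [ContinuousLinearMap.coe_coe, hSx]
      exact Submodule.sum_mem _ fun i _ =>
        Submodule.smul_mem _ _ (Submodule.subset_span ⟨i, rfl⟩)
    · simpa only [hSx, hA] using hq

end
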